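/- Let (Ω, 𝓕, P) be a probability space with a filtration (𝓕_k)_{k=0,…,K} (K ≥ 1), d ∈ ℕ with d ≥ 1, and Δ > 0. Let Λ ∈ Matrix(d,d,ℝ) be fixed and let ς : ℝ^d → Matrix(d,d,ℝ) be a measurable map such that ς(x) is invertible for every x. For each k = 1,…,K let ε_k : Ω → ℝ^d be a standard Gaussian vector that is 𝓕_k-measurable and independent of 𝓕_{k−1}; let Y_k : Ω → ℝ^d and r_k : Ω → ℝ be 𝓕_{k−1}-measurable with r_k, the entries of ς(Y_k), and the entries of ς(Y_k)^{-1} uniformly bounded. Define Σ_Λ(x) := ς(x) Λ Λᵀ ς(x)ᵀ, Υ_k := Δ·(−r_k·𝟙 + ½·diag(Σ_Λ(Y_k))) + √Δ·ς(Y_k) Λ ε_k, the random matrix C_K ∈ Matrix(d,K,ℝ) whose k-th column is (1/√K)·ς(Y_k)^{-1} Υ_k, S_K(y) := ς(y) C_K C_Kᵀ ς(y)ᵀ for y ∈ ℝ^d, and f_Λ(z, x) := ς(x)^{-1}·(−z + ½·diag(Σ_Λ(x)))·(−z + ½·diag(Σ_Λ(x)))ᵀ·(ς(x)^{-1})ᵀ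 for z, x ∈ ℝ^d. Then, almost surely, E[S_K(y) | 𝓕_{K−1}] = ((K−1)/K)·S_{K−1}(y) + (Δ/K)·Σ_Λ(y) + (Δ²/K)·ς(y)·f_Λ(r_K·𝟙, Y_K)·ς(y)ᵀ (entrywise conditional expectation), where S_{K−1}(y) is built from the first K−1 columns with normalization 1/√(K−1) (interpreted as the zero matrix when K = 1). -/

import Mathlib

open MeasureTheory ProbabilityTheory Matrix

section Measurability

variable {α n : Type*} {mα : MeasurableSpace α} [Fintype n] [DecidableEq n]

theorem measurable_matrix_det {A : α → Matrix n n ℝ}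
    (hA : ∀ i j, Measurable fun x => A x i j) : Measurable fun x => (A x).det := by
  simp only [det_apply]
  exact Finset.measurable_sum _ fun σ _ =>
    (Finset.measurable_prod _ fun i _ => hA _ _).const_smul _

theorem measurable_matrix_inv_apply {A : α → Matrix n n ℝ}
    (hA : ∀ i j, Measurable fun x => A x i j) (i j : n) :
    Measurable fun x => (A x)⁻¹ i j := by
  simp only [inv_def, Ring.inverse_eq_inv', Matrix.smul_apply, smul_eq_mul, adjugate_apply]
  refine (measurable_matrix_det hA).inv.mul (measurable_matrix_det fun k l => ?_)
  simp only [updateRow_apply]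
  split_ifs
  · exact measurable_const
  · exact hA k l

end Measurability

section GaussianMoments

variable {Ω ι : Type*} {mΩ : MeasurableSpace Ω} {P : Measure Ω} [Fintype ι] {X : Ω → ι → ℝ}

theorem hasLaw_eval_of_map_eq_pi_gaussianReal (hX : Measurable X)
    (hlaw : P.map X = Measure.pi fun _ => gaussianReal 0 1) (i : ι) :
    HasLaw (fun ω => X ω i) (gaussianReal 0 1) P where
  aemeasurable := (measurable_pi_iff.1 hX i).aemeasurable
  map_eq := by
    rw [← (measurePreserving_eval (fun _ : ι => gaussianReal 0 1) i).map_eq, ← hlaw,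
      Measure.map_map (measurable_pi_apply i) hX]
    rfl

theorem memLp_eval_of_map_eq_pi_gaussianReal (hX : Measurable X)
    (hlaw : P.map X = Measure.pi fun _ => gaussianReal 0 1) (i : ι) :
    MemLp (fun ω => X ω i) 2 P := by
  have h := hasLaw_eval_of_map_eq_pi_gaussianReal hX hlaw i
  have := memLp_id_gaussianReal (μ := 0) (v := 1) 2
  rw [← h.map_eq] at this
  exact (memLp_map_measure_iff aestronglyMeasurable_id h.aemeasurable).1 this

theorem integral_eval_of_map_eq_pi_gaussianReal (hX : Measurable X)
    (hlaw : P.map X = Measure.pi fun _ => gaussianReal 0 1) (i : ι) :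
    ∫ ω, X ω i ∂P = 0 := by
  rw [(hasLaw_eval_of_map_eq_pi_gaussianReal hX hlaw i).integral_eq, integral_id_gaussianReal]

theorem integral_eval_mul_eval_of_map_eq_pi_gaussianReal [IsProbabilityMeasure P]
    [DecidableEq ι] (hX : Measurable X)
    (hlaw : P.map X = Measure.pi fun _ => gaussianReal 0 1) (i j : ι) :
    ∫ ω, X ω i * X ω j ∂P = if i = j then 1 else 0 := by
  have hmi (i : ι) := integral_eval_of_map_eq_pi_gaussianReal hX hlaw i
  split_ifs with hij
  · subst hij
    have h := hasLaw_eval_of_map_eq_pi_gaussianReal hX hlaw i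
    have hv := h.variance_eq
    rw [variance_id_gaussianReal, variance_eq_integral h.aemeasurable, hmi] at hv
    simpa [sq] using hv
  · have hind : iIndepFun (fun i ω => X ω i) P := by
      rw [iIndepFun_iff_map_fun_eq_pi_map fun i => (measurable_pi_iff.1 hX i).aemeasurable]
      simp only [(hasLaw_eval_of_map_eq_pi_gaussianReal hX hlaw _).map_eq]
      exact hlaw
    rw [(hind.indepFun hij).integral_fun_mul_eq_mul_integral
      (measurable_pi_iff.1 hX i).aestronglyMeasurable
      (measurable_pi_iff.1 hX j).aestronglyMeasurable, hmi, zero_mul]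

variable {κ : Type*} (M : Matrix κ ι ℝ)

theorem memLp_mulVec_of_map_eq_pi_gaussianReal (hX : Measurable X)
    (hlaw : P.map X = Measure.pi fun _ => gaussianReal 0 1) (i : κ) :
    MemLp (fun ω => (M *ᵥ X ω) i) 2 P := by
  simp only [mulVec, dotProduct]
  exact memLp_finsetSum _ fun j _ =>
    (memLp_eval_of_map_eq_pi_gaussianReal hX hlaw j).const_mul _

theorem integral_mulVec_of_map_eq_pi_gaussianReal [IsProbabilityMeasure P] (hX : Measurable X)
    (hlaw : P.map X = Measure.pi fun _ => gaussianReal 0 1) (i : κ) :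
    ∫ ω, (M *ᵥ X ω) i ∂P = 0 := by
  simp only [mulVec, dotProduct]
  rw [integral_finsetSum _ fun j _ => ((memLp_eval_of_map_eq_pi_gaussianReal hX hlaw j).integrable
    one_le_two).const_mul _]
  simp [integral_const_mul, integral_eval_of_map_eq_pi_gaussianReal hX hlaw]

theorem integral_mulVec_mul_mulVec_of_map_eq_pi_gaussianReal [IsProbabilityMeasure P]
    (hX : Measurable X)
    (hlaw : P.map X = Measure.pi fun _ => gaussianReal 0 1) (i j : κ) :
    ∫ ω, (M *ᵥ X ω) i * (M *ᵥ X ω) j ∂P = (M * Mᵀ) i j := by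
  classical
  have integrable_term (k l : ι) : Integrable (fun ω => M i k * X ω k * (M j l * X ω l)) P :=
    ((memLp_eval_of_map_eq_pi_gaussianReal hX hlaw k).const_mul _).integrable_mul
      ((memLp_eval_of_map_eq_pi_gaussianReal hX hlaw l).const_mul _)
  simp only [mulVec, dotProduct, Finset.sum_mul_sum]
  rw [integral_finsetSum _ fun k _ => integrable_finsetSum _ fun l _ => integrable_term k l]
  have hval (k l : ι) : ∫ ω, M i k * X ω k * (M j l * X ω l) ∂P
      = if k = l then M i k * M j l else 0 := by
    rw [integral_congr_ae (.of_forall fun ω => mul_mul_mul_comm (M i k) (X ω k) (M j l) (X ω l)),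
      integral_const_mul, integral_eval_mul_eval_of_map_eq_pi_gaussianReal hX hlaw, mul_ite,
      mul_one, mul_zero]
  rw [Finset.sum_congr rfl fun k _ => integral_finsetSum _ fun l _ => integrable_term k l]
  simp [hval, Matrix.mul_apply]

end GaussianMoments

/-- Conditional second moments of `a + M X`, where `a` is known and `X` is an independent standard
Gaussian vector. -/
theorem condExp_add_mulVec_mul_add_mulVec {Ω ι κ : Type*} {m mΩ : MeasurableSpace Ω}
    {P : Measure Ω} [IsProbabilityMeasure P] [Fintype ι] (M : Matrix κ ι ℝ) {X : Ω → ι → ℝ}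
    (hm : m ≤ mΩ) (hX : Measurable X)
    (hlaw : P.map X = Measure.pi fun _ => gaussianReal 0 1)
    (hind : Indep (MeasurableSpace.comap X inferInstance) m P) {a : Ω → κ → ℝ}
    (ha : ∀ i, Measurable[m] fun ω => a ω i) (ha2 : ∀ i, MemLp (fun ω => a ω i) 2 P) (i j : κ) :
    P[fun ω => (a ω i + (M *ᵥ X ω) i) * (a ω j + (M *ᵥ X ω) j) | m]
      =ᵐ[P] fun ω => a ω i * a ω j + (M * Mᵀ) i j := by
  set g : κ → Ω → ℝ := fun i ω => (M *ᵥ X ω) i with hg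
  have hgL (i : κ) : MemLp (g i) 2 P := memLp_mulVec_of_map_eq_pi_gaussianReal M hX hlaw i
  have hgm (i : κ) : StronglyMeasurable[MeasurableSpace.comap X inferInstance] (g i) := by
    have : Measurable fun x : ι → ℝ => (M *ᵥ x) i := by
      simp only [mulVec, dotProduct]
      fun_prop
    exact (this.comp (comap_measurable X)).stronglyMeasurable
  have hcross (i j : κ) : P[(fun ω => a ω i) * g j | m] =ᵐ[P] 0 := by
    filter_upwards [condExp_mul_of_stronglyMeasurable_left (ha i).stronglyMeasurable
        ((ha2 i).integrable_mul (hgL j)) ((hgL j).integrable one_le_two),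
      condExp_indep_eq hX.comap_le hm (hgm j) hind] with ω h₁ h₂
    rw [h₁, Pi.mul_apply, h₂, integral_mulVec_of_map_eq_pi_gaussianReal M hX hlaw j]
    simp
  have hgg : P[g i * g j | m] =ᵐ[P] fun _ => (M * Mᵀ) i j := by
    refine (condExp_indep_eq hX.comap_le hm ((hgm i).mul (hgm j)) hind).trans ?_
    rw [← integral_mulVec_mul_mulVec_of_map_eq_pi_gaussianReal M hX hlaw]
    rfl
  have haa : Integrable ((fun ω => a ω i) * fun ω => a ω j) P := (ha2 i).integrable_mul (ha2 j)
  have hag (i j : κ) : Integrable ((fun ω => a ω i) * g j) P := (ha2 i).integrable_mul (hgL j)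
  have hsplit : (fun ω => (a ω i + (M *ᵥ X ω) i) * (a ω j + (M *ᵥ X ω) j))
      = (((fun ω => a ω i) * fun ω => a ω j) + (fun ω => a ω i) * g j)
        + ((fun ω => a ω j) * g i + g i * g j) := by
    ext ω
    simp only [hg, Pi.add_apply, Pi.mul_apply]
    ring
  rw [hsplit]
  filter_upwards [condExp_add (haa.add (hag i j))
      ((hag j i).add ((hgL i).integrable_mul (hgL j))) m,
    condExp_add haa (hag i j) m, condExp_add (hag j i) ((hgL i).integrable_mul (hgL j)) m,
    hcross i j, hcross j i, hgg] with ω h₁ h₂ h₃ h₄ h₅ h₆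
  rw [h₁, Pi.add_apply, h₂, h₃, Pi.add_apply, Pi.add_apply, h₄, h₅, h₆,
    condExp_of_stronglyMeasurable hm ((ha i).mul (ha j)).stronglyMeasurable haa]
  simp

section MatrixEntries

variable {α l m n : Type*} [Fintype m]

theorem measurable_matrix_mul_apply {mα : MeasurableSpace α} {A : α → Matrix l m ℝ}
    {B : α → Matrix m n ℝ} (hA : ∀ i j, Measurable fun x => A x i j)
    (hB : ∀ i j, Measurable fun x => B x i j) (i : l) (j : n) :
    Measurable fun x => (A x * B x) i j := by
  simp only [Matrix.mul_apply]
  exact Finset.measurable_sum _ fun k _ => (hA i k).mul (hB k j)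

theorem measurable_mulVec_apply {mα : MeasurableSpace α} {A : α → Matrix l m ℝ} {v : α → m → ℝ}
    (hA : ∀ i j, Measurable fun x => A x i j) (hv : ∀ i, Measurable fun x => v x i) (i : l) :
    Measurable fun x => (A x *ᵥ v x) i := by
  simp only [mulVec, dotProduct]
  exact Finset.measurable_sum _ fun k _ => (hA i k).mul (hv k)

theorem memLp_top_matrix_mul_apply {mα : MeasurableSpace α} {μ : Measure α} {A : α → Matrix l m ℝ}
    {B : α → Matrix m n ℝ} (hA : ∀ i j, MemLp (fun x => A x i j) ⊤ μ)
    (hB : ∀ i j, MemLp (fun x => B x i j) ⊤ μ) (i : l) (j : n) :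
    MemLp (fun x => (A x * B x) i j) ⊤ μ := by
  simp only [Matrix.mul_apply]
  exact memLp_finsetSum _ fun k _ => (hB k j).mul' (hA i k)

theorem memLp_top_mulVec_apply {mα : MeasurableSpace α} {μ : Measure α} {A : α → Matrix l m ℝ}
    {v : α → m → ℝ} (hA : ∀ i j, MemLp (fun x => A x i j) ⊤ μ)
    (hv : ∀ i, MemLp (fun x => v x i) ⊤ μ) (i : l) :
    MemLp (fun x => (A x *ᵥ v x) i) ⊤ μ := by
  simp only [mulVec, dotProduct]
  exact memLp_finsetSum _ fun k _ => (hv k).mul' (hA i k)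

theorem mul_vecMulVec_self_mul_transpose (A : Matrix l m ℝ) (z : m → ℝ) :
    A * vecMulVec z z * Aᵀ = vecMulVec (A *ᵥ z) (A *ᵥ z) := by
  rw [mul_vecMulVec, vecMulVec_mul, vecMul_transpose]

theorem mul_of_sum_mul_mul_transpose_apply {κ : Type*} (A : Matrix l m ℝ) (c : ℝ) (s : Finset κ)
    (z : κ → m → ℝ) (i j : l) :
    (A * (Matrix.of fun p q => c * ∑ k ∈ s, z k p * z k q) * Aᵀ) i j
      = c * ∑ k ∈ s, (A *ᵥ z k) i * (A *ᵥ z k) j := by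
  have h : (Matrix.of fun p q => c * ∑ k ∈ s, z k p * z k q)
      = c • ∑ k ∈ s, vecMulVec (z k) (z k) := by
    ext p q
    simp [Matrix.sum_apply, vecMulVec_apply]
  rw [h, Matrix.mul_smul, Matrix.smul_mul, Matrix.mul_sum, Matrix.sum_mul]
  simp [mul_vecMulVec_self_mul_transpose, Matrix.sum_apply, vecMulVec_apply]

end MatrixEntries

theorem sum_Icc_one_eq_sum_fin {M : Type*} [AddCommMonoid M] (f : ℕ → M) (n : ℕ) :
    ∑ k ∈ Finset.Icc 1 n, f k = ∑ k : Fin n, f (k + 1) := by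
  induction n with
  | zero => simp
  | succ n ih => simp [Finset.sum_Icc_succ_top, ih, Fin.sum_univ_castSucc]

/-- One-step recursion in the proof of Theorem 4.1: conditionally on `𝓕_{K−1}`,
`E[S_K(y) | 𝓕_{K−1}] = ((K−1)/K)·S_{K−1}(y) + (Δ/K)·Σ_Λ(y)
  + (Δ²/K)·ς(y)·f_Λ(r_K·𝟙, Y_K)·ς(y)ᵀ` a.s. (entrywise), where `S_{K−1}(y)` is built
from the first `K−1` columns with normalization `1/√(K−1)` (the zero matrix if `K = 1`). -/
theorem consistent_yield_estimator_one_step_recursion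
    {Ω : Type*} {mΩ : MeasurableSpace Ω} (P : Measure Ω) [IsProbabilityMeasure P]
    (K : ℕ) (hK : 1 ≤ K) (d : ℕ) (hd : 1 ≤ d) (Δ : ℝ) (hΔ : 0 < Δ)
    (𝓕 : ℕ → MeasurableSpace Ω) (h𝓕_mono : Monotone 𝓕) (h𝓕_le : ∀ k, 𝓕 k ≤ mΩ)
    (L : Matrix (Fin d) (Fin d) ℝ)
    (ς : (Fin d → ℝ) → Matrix (Fin d) (Fin d) ℝ)
    (hς_meas : ∀ i j, Measurable fun x => ς x i j)
    (hς_inv : ∀ x, IsUnit (ς x).det)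
    (ε : ℕ → Ω → (Fin d → ℝ))
    (hε_meas : ∀ k ∈ Finset.Icc 1 K, Measurable[𝓕 k] (ε k))
    (hε_law : ∀ k ∈ Finset.Icc 1 K,
      @Measure.map Ω (Fin d → ℝ) mΩ _ (ε k) P
        = Measure.pi (fun _ : Fin d => gaussianReal 0 1))
    (hε_indep : ∀ k ∈ Finset.Icc 1 K,
      Indep (MeasurableSpace.comap (ε k) inferInstance) (𝓕 (k - 1)) P)
    (Y : ℕ → Ω → (Fin d → ℝ)) (r : ℕ → Ω → ℝ)
    (hY_meas : ∀ k ∈ Finset.Icc 1 K, Measurable[𝓕 (k - 1)] (Y k))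
    (hr_meas : ∀ k ∈ Finset.Icc 1 K, Measurable[𝓕 (k - 1)] (r k))
    (Cb : ℝ)
    (h_bd : ∀ k ∈ Finset.Icc 1 K, ∀ ω, |r k ω| ≤ Cb
      ∧ (∀ i j, |ς (Y k ω) i j| ≤ Cb) ∧ (∀ i j, |(ς (Y k ω))⁻¹ i j| ≤ Cb))
    (SgL : (Fin d → ℝ) → Matrix (Fin d) (Fin d) ℝ)
    (hSgL : ∀ x, SgL x = ς x * L * Lᵀ * (ς x)ᵀ)
    (Υ : ℕ → Ω → (Fin d → ℝ))
    (hΥ : ∀ k ∈ Finset.Icc 1 K, ∀ ω, ∀ j, Υ k ω j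
      = Δ * (-(r k ω) + SgL (Y k ω) j j / 2) + Real.sqrt Δ * ((ς (Y k ω) * L) *ᵥ ε k ω) j)
    (CK : Ω → Matrix (Fin d) (Fin K) ℝ)
    (hCK : ∀ ω, ∀ i, ∀ k : Fin K,
      CK ω i k = (Real.sqrt K)⁻¹ * ((ς (Y ((k : ℕ) + 1) ω))⁻¹ *ᵥ Υ ((k : ℕ) + 1) ω) i)
    (fL : (Fin d → ℝ) → (Fin d → ℝ) → Matrix (Fin d) (Fin d) ℝ)
    (hfL : ∀ z x, fL z x = (ς x)⁻¹
      * vecMulVec (fun j => -z j + SgL x j j / 2) (fun j => -z j + SgL x j j / 2)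
      * ((ς x)⁻¹)ᵀ)
    (y : Fin d → ℝ)
    (S : Ω → Matrix (Fin d) (Fin d) ℝ)
    (hS : ∀ ω, S ω = ς y * (CK ω * (CK ω)ᵀ) * (ς y)ᵀ)
    -- `S'` is the estimator built from the first `K − 1` columns, with normalization
    -- `1/√(K−1)`; it is the zero matrix when `K = 1` (empty sum).
    (S' : Ω → Matrix (Fin d) (Fin d) ℝ)
    (hS' : ∀ ω, S' ω = ς y * (Matrix.of fun i j =>
        ((K - 1 : ℕ) : ℝ)⁻¹ * ∑ k ∈ Finset.Icc 1 (K - 1),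
          ((ς (Y k ω))⁻¹ *ᵥ Υ k ω) i * ((ς (Y k ω))⁻¹ *ᵥ Υ k ω) j) * (ς y)ᵀ) :
    ∀ i j,
      (P[fun ω => S ω i j | 𝓕 (K - 1)])
        =ᵐ[P] fun ω =>
          (((K - 1 : ℕ) : ℝ) / K) * S' ω i j + (Δ / K) * SgL y i j
            + (Δ ^ 2 / K) * (ς y * fL (fun _ => r K ω) (Y K ω) * (ς y)ᵀ) i j := by
  intro i j
  obtain ⟨n, rfl⟩ : ∃ n, K = n + 1 := ⟨K - 1, by omega⟩
  have hSgL_meas (p q) : Measurable fun x => SgL x p q := by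
    simp only [hSgL]
    have hconst (N : Matrix (Fin d) (Fin d) ℝ) (p q) :
      Measurable fun _ : Fin d → ℝ => N p q := measurable_const
    exact measurable_matrix_mul_apply (measurable_matrix_mul_apply
      (measurable_matrix_mul_apply hς_meas (hconst L)) (hconst Lᵀ)) (fun p q => hς_meas q p) p q
  set v : ℕ → Ω → Fin d → ℝ := fun k ω p => -(r k ω) + SgL (Y k ω) p p / 2 with hv
  set a : ℕ → Ω → Fin d → ℝ := fun k ω => Δ • ((ς y * (ς (Y k ω))⁻¹) *ᵥ v k ω) with ha
  set u : ℕ → Ω → Fin d → ℝ := fun k ω => ς y *ᵥ ((ς (Y k ω))⁻¹ *ᵥ Υ k ω) with hu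
  set M : Matrix (Fin d) (Fin d) ℝ := Real.sqrt Δ • (ς y * L) with hM
  have hu_eq (k) (hk : k ∈ Finset.Icc 1 (n + 1)) (ω) : u k ω = a k ω + M *ᵥ ε k ω := by
    have hΥ' : Υ k ω = Δ • v k ω + Real.sqrt Δ • ((ς (Y k ω) * L) *ᵥ ε k ω) := by
      ext p
      simp [hΥ k hk, hv]
    simp only [hu, ha, hM, hΥ', mulVec_add, mulVec_smul, mulVec_mulVec, smul_mulVec]
    rw [Matrix.mul_assoc (ς y), ← Matrix.mul_assoc (ς (Y k ω))⁻¹, nonsing_inv_mul _ (hς_inv _),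
      Matrix.one_mul]
  have hε (k) (hk : k ∈ Finset.Icc 1 (n + 1)) : Measurable (ε k) :=
    (hε_meas k hk).mono (h𝓕_le k) le_rfl
  have ha_meas (k) (hk : k ∈ Finset.Icc 1 (n + 1)) (p) :
      Measurable[𝓕 (k - 1)] fun ω => a k ω p := by
    have hv_meas (q) : Measurable[𝓕 (k - 1)] fun ω => v k ω q :=
      (hr_meas k hk).neg.add (((hSgL_meas q q).comp (hY_meas k hk)).div_const 2)
    have hB_meas (p q) : Measurable[𝓕 (k - 1)] fun ω => (ς y * (ς (Y k ω))⁻¹) p q :=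
      measurable_matrix_mul_apply (A := fun _ => ς y) (B := fun ω => (ς (Y k ω))⁻¹)
        (fun _ _ => measurable_const)
        (fun p q => (measurable_matrix_inv_apply hς_meas p q).comp (hY_meas k hk)) p q
    exact (measurable_mulVec_apply hB_meas hv_meas p).const_mul Δ
  have ha_memLp (k) (hk : k ∈ Finset.Icc 1 (n + 1)) (p) : MemLp (fun ω => a k ω p) 2 P := by
    have hYk : Measurable (Y k) := (hY_meas k hk).mono (h𝓕_le _) le_rfl
    have hrk : Measurable (r k) := (hr_meas k hk).mono (h𝓕_le _) le_rfl
    have hςL (p q) : MemLp (fun ω => ς (Y k ω) p q) ⊤ P :=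
      .of_bound ((hς_meas p q).comp hYk).aestronglyMeasurable Cb
        (.of_forall fun ω => (h_bd k hk ω).2.1 p q)
    have hinvL (p q) : MemLp (fun ω => (ς (Y k ω))⁻¹ p q) ⊤ P :=
      .of_bound ((measurable_matrix_inv_apply hς_meas p q).comp hYk).aestronglyMeasurable Cb
        (.of_forall fun ω => (h_bd k hk ω).2.2 p q)
    have hrL : MemLp (r k) ⊤ P :=
      .of_bound hrk.aestronglyMeasurable Cb (.of_forall fun ω => (h_bd k hk ω).1)
    have hconst (N : Matrix (Fin d) (Fin d) ℝ) (p q) : MemLp (fun _ : Ω => N p q) ⊤ P :=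
      memLp_const _
    have hSL (p q) : MemLp (fun ω => SgL (Y k ω) p q) ⊤ P := by
      simp only [hSgL]
      exact memLp_top_matrix_mul_apply (memLp_top_matrix_mul_apply
        (memLp_top_matrix_mul_apply hςL (hconst L)) (hconst Lᵀ)) (fun p q => hςL q p) p q
    have hvL (q) : MemLp (fun ω => v k ω q) ⊤ P := by
      simp only [hv, div_eq_inv_mul]
      exact hrL.neg.add ((hSL q q).const_mul 2⁻¹)
    have haL := (memLp_top_mulVec_apply
      (memLp_top_matrix_mul_apply (hconst (ς y)) hinvL) hvL p).const_mul Δ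
    exact haL.mono_exponent le_top
  have hu_meas (k) (hk : k ∈ Finset.Icc 1 (n + 1)) (p) : Measurable[𝓕 k] fun ω => u k ω p := by
    simp only [hu_eq k hk]
    exact ((ha_meas k hk p).mono (h𝓕_mono (Nat.sub_le k 1)) le_rfl).add
      (measurable_mulVec_apply (A := fun _ => M) (v := ε k) (fun _ _ => measurable_const)
        (fun q => (measurable_pi_apply q).comp (hε_meas k hk)) p)
  have hu_memLp (k) (hk : k ∈ Finset.Icc 1 (n + 1)) (p) : MemLp (fun ω => u k ω p) 2 P := by
    simp only [hu_eq k hk]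
    exact (ha_memLp k hk p).add
      (memLp_mulVec_of_map_eq_pi_gaussianReal M (hε k hk) (hε_law k hk) p)
  have hu_int (k) (hk : k ∈ Finset.Icc 1 (n + 1)) : Integrable (fun ω => u k ω i * u k ω j) P :=
    (hu_memLp k hk i).integrable_mul (hu_memLp k hk j)
  have hlast : n + 1 ∈ Finset.Icc 1 (n + 1) := by simp
  have mem_of_mem {k} (hk : k ∈ Finset.Icc 1 n) : k ∈ Finset.Icc 1 (n + 1) := by
    simp only [Finset.mem_Icc] at hk ⊢
    omega
  set H : Ω → ℝ := fun ω => ∑ k ∈ Finset.Icc 1 n, u k ω i * u k ω j with hH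
  have hH_meas : Measurable[𝓕 n] H := Finset.measurable_sum _ fun k hk =>
    ((hu_meas k (mem_of_mem hk) i).mul (hu_meas k (mem_of_mem hk) j)).mono
      (h𝓕_mono (Finset.mem_Icc.1 hk).2) le_rfl
  have hH_int : Integrable H P := integrable_finsetSum _ fun k hk => hu_int k (mem_of_mem hk)
  have hS_eq : (fun ω => S ω i j)
      = ((n + 1 : ℕ) : ℝ)⁻¹ • (H + fun ω => u (n + 1) ω i * u (n + 1) ω j) := by
    ext ω
    have hCC : CK ω * (CK ω)ᵀ = Matrix.of fun p q => ((n + 1 : ℕ) : ℝ)⁻¹ *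
        ∑ k ∈ Finset.Icc 1 (n + 1),
          ((ς (Y k ω))⁻¹ *ᵥ Υ k ω) p * ((ς (Y k ω))⁻¹ *ᵥ Υ k ω) q := by
      ext p q
      have hsq : (Real.sqrt (n + 1 : ℕ))⁻¹ * (Real.sqrt (n + 1 : ℕ))⁻¹ = ((n + 1 : ℕ) : ℝ)⁻¹ := by
        rw [← mul_inv, Real.mul_self_sqrt (Nat.cast_nonneg _)]
      simp only [Matrix.mul_apply, transpose_apply, hCK, Matrix.of_apply, sum_Icc_one_eq_sum_fin,
        Finset.mul_sum]
      exact Finset.sum_congr rfl fun k _ => by rw [mul_mul_mul_comm, hsq]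
    rw [hS, hCC, mul_of_sum_mul_mul_transpose_apply, Finset.sum_Icc_succ_top (by omega)]
    rfl
  have hS'_eq (ω) : S' ω i j = (n : ℝ)⁻¹ * H ω := by
    rw [hS', mul_of_sum_mul_mul_transpose_apply]
    rfl
  have hMM : (M * Mᵀ) i j = Δ * SgL y i j := by
    rw [hSgL, hM, transpose_smul, transpose_mul, Matrix.smul_mul, Matrix.mul_smul, smul_smul,
      Real.mul_self_sqrt hΔ.le, Matrix.smul_apply, smul_eq_mul]
    simp only [Matrix.mul_assoc]
  have hf_eq (ω) : Δ ^ 2 * (ς y * fL (fun _ => r (n + 1) ω) (Y (n + 1) ω) * (ς y)ᵀ) i j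
      = a (n + 1) ω i * a (n + 1) ω j := by
    rw [hfL, mul_vecMulVec_self_mul_transpose, mul_vecMulVec_self_mul_transpose, mulVec_mulVec,
      vecMulVec_apply]
    simp only [ha, hv, Pi.smul_apply, smul_eq_mul]
    ring
  have hcond : P[fun ω => u (n + 1) ω i * u (n + 1) ω j | 𝓕 n]
      =ᵐ[P] fun ω => a (n + 1) ω i * a (n + 1) ω j + (M * Mᵀ) i j := by
    simp only [hu_eq _ hlast]
    exact condExp_add_mulVec_mul_add_mulVec M (h𝓕_le n) (hε _ hlast) (hε_law _ hlast)
      (hε_indep _ hlast) (ha_meas _ hlast) (ha_memLp _ hlast) i j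
  rw [hS_eq, Nat.add_sub_cancel]
  filter_upwards [condExp_smul ((n + 1 : ℕ) : ℝ)⁻¹
      (H + fun ω => u (n + 1) ω i * u (n + 1) ω j) (𝓕 n),
    condExp_add hH_int (hu_int _ hlast) (𝓕 n), hcond] with ω h₁ h₂ h₃
  rw [h₁, Pi.smul_apply, h₂, Pi.add_apply, h₃,
    condExp_of_stronglyMeasurable (h𝓕_le n) hH_meas.stronglyMeasurable hH_int, hMM, ← hf_eq, hS'_eq,
    smul_eq_mul]
  have hnH : (n : ℝ) * ((n : ℝ)⁻¹ * H ω) = H ω := by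
    rcases eq_or_ne n 0 with rfl | hn
    · simp [hH]
    · rw [mul_inv_cancel_left₀ (Nat.cast_ne_zero.2 hn)]
  linear_combination (-((n + 1 : ℕ) : ℝ)⁻¹) * hnH
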